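/- Let n be a positive natural number and let J = Matrix.fromBlocks 0 1 (-1) 0 be the standard symplectic matrix of size 2n×2n over ℝ. The set sp(2n,ℝ) = {X : Xᵀ * J + J * X = 0}, regarded as an ℝ-submodule of the 2n×2n real matrices, has dimension (finrank) n*(2n+1). In particular for n = 4, the symplectic Lie algebra sp(8,ℝ) has real dimension 36. -/

import Mathlib

open Matrix

/-- The submodule of symmetric square matrices. -/
def Matrix.symmetricSubmodule (R ι : Type*) [CommRing R] : Submodule R (Matrix ι ι R) where
  carrier := {A | A.IsSymm}
  add_mem' hA hB := hA.add hB
  zero_mem' := Matrix.isSymm_zero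
  smul_mem' c _ hA := hA.smul c

/-- Symmetric matrices are the same as functions on unordered pairs of indices. -/
def Matrix.symmetricSubmoduleEquiv (R ι : Type*) [CommRing R] :
    symmetricSubmodule R ι ≃ₗ[R] (Sym2 ι → R) where
  toFun A := Sym2.lift ⟨fun i j => A.1 i j, fun i j => (A.2.apply i j).symm⟩
  invFun f := ⟨Matrix.of fun i j => f s(i, j), by
    refine Matrix.IsSymm.ext fun i j => ?_
    simp [Sym2.eq_swap]⟩
  map_add' A B := by
    funext p
    induction p with | _ i j => simp
  map_smul' c A := by
    funext p
    induction p with | _ i j => simp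
  left_inv A := by
    ext i j
    simp
  right_inv f := by
    funext p
    induction p with | _ i j => simp

theorem Matrix.finrank_symmetricSubmodule (R ι : Type*) [CommRing R] [StrongRankCondition R]
    [Fintype ι] :
    Module.finrank R (symmetricSubmodule R ι) = (Fintype.card ι + 1).choose 2 := by
  classical
  rw [(symmetricSubmoduleEquiv R ι).finrank_eq, Module.finrank_fintype_fun_eq_card, Sym2.card]

theorem sp_dimension
    (n : ℕ) (hn : 0 < n)
    (J : Matrix ((Fin n) ⊕ (Fin n)) ((Fin n) ⊕ (Fin n)) ℝ)
    (hJ : J = Matrix.fromBlocks 0 1 (-1) 0) :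
    ∃ N : Submodule ℝ (Matrix ((Fin n) ⊕ (Fin n)) ((Fin n) ⊕ (Fin n)) ℝ),
      (N : Set (Matrix ((Fin n) ⊕ (Fin n)) ((Fin n) ⊕ (Fin n)) ℝ)) =
        {X | Xᵀ * J + J * X = 0} ∧
      Module.finrank ℝ N = n * (2 * n + 1) := by
  have hJJ : J * J = -1 := by
    rw [hJ, Matrix.fromBlocks_multiply, ← Matrix.fromBlocks_one, Matrix.fromBlocks_neg]
    simp
  have hJT : Jᵀ = -J := by
    rw [hJ, Matrix.fromBlocks_transpose, Matrix.fromBlocks_neg]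
    simp
  let e : Matrix (Fin n ⊕ Fin n) (Fin n ⊕ Fin n) ℝ ≃ₗ[ℝ]
      Matrix (Fin n ⊕ Fin n) (Fin n ⊕ Fin n) ℝ :=
    LinearEquiv.ofLinearMap (LinearMap.mulLeft ℝ J) (LinearMap.mulLeft ℝ (-J))
      (LinearMap.ext fun X => by simp [← mul_assoc, hJJ])
      (LinearMap.ext fun X => by simp [← mul_assoc, hJJ])
  refine ⟨(symmetricSubmodule ℝ _).map e.symm.toLinearMap, ?_, ?_⟩
  · ext X
    rw [SetLike.mem_coe, Submodule.mem_map_equiv, LinearEquiv.symm_symm]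
    change (J * X)ᵀ = J * X ↔ Xᵀ * J + J * X = 0
    rw [Matrix.transpose_mul, hJT, mul_neg, neg_eq_iff_add_eq_zero]
  · rw [LinearEquiv.finrank_map_eq, finrank_symmetricSubmodule, Fintype.card_sum, Fintype.card_fin,
      Nat.choose_two_right, Nat.add_sub_cancel]
    exact Nat.div_eq_of_eq_mul_left two_pos (by ring)
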